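/- Let u : ℂ → ℝ be smooth, λ ∈ ℂ\{0}, let (ψ₁, ψ₂) solve system (Ψ_λ) and (φ₁, φ₂) solve system (Φ_λ). Set ω = ψ₁φ₁ − ψ₂φ₂ and φ = −i e^{−u} ψ₂φ₁ − i λ⁻¹ e^{u} ψ₁φ₂. Then ∂φ = 2 ∂u · ∂ω and λ⁻¹ ω = 2 φ · ∂u − ∂²ω hold identically on ℂ. -/

import Mathlib

noncomputable section

open Complex Matrix

/-- Wirtinger derivative `∂f = (1/2)(f_x - i f_y)`. -/
def wd (f : ℂ → ℂ) (z : ℂ) : ℂ :=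
  (fderiv ℝ f z 1 - Complex.I * fderiv ℝ f z Complex.I) / 2

/-- Conjugate Wirtinger derivative `∂̄f = (1/2)(f_x + i f_y)`. -/
def wdb (f : ℂ → ℂ) (z : ℂ) : ℂ :=
  (fderiv ℝ f z 1 + Complex.I * fderiv ℝ f z Complex.I) / 2

/-- Complexification of a real-valued function. -/
def cx (u : ℂ → ℝ) : ℂ → ℂ := fun z => (u z : ℂ)

/-- Entrywise Wirtinger derivative of a matrix-valued function. -/
def mwd (F : ℂ → Matrix (Fin 2) (Fin 2) ℂ) (z : ℂ) : Matrix (Fin 2) (Fin 2) ℂ :=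
  Matrix.of fun i j => wd (fun w => F w i j) z

/-- Entrywise conjugate Wirtinger derivative of a matrix-valued function. -/
def mwdb (F : ℂ → Matrix (Fin 2) (Fin 2) ℂ) (z : ℂ) : Matrix (Fin 2) (Fin 2) ℂ :=
  Matrix.of fun i j => wdb (fun w => F w i j) z

/-- Entrywise Wirtinger derivative of a vector-valued function. -/
def vwd (v : ℂ → Fin 2 → ℂ) (z : ℂ) : Fin 2 → ℂ := fun i => wd (fun w => v w i) z

/-- Entrywise conjugate Wirtinger derivative of a vector-valued function. -/
def vwdb (v : ℂ → Fin 2 → ℂ) (z : ℂ) : Fin 2 → ℂ := fun i => wdb (fun w => v w i) z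

/-- `u` solves the sinh-Gordon equation `∂∂̄u + (1/2) sinh (2u) = 0`. -/
def SinhGordon (u : ℂ → ℝ) : Prop :=
  ∀ z, wd (wdb (cx u)) z + (1/2) * Complex.sinh (2 * (u z : ℂ)) = 0

/-- `(ψ₁, ψ₂)` solves the system `(Ψ_λ)`. -/
def SolPsi (u : ℂ → ℝ) (lam : ℂ) (p1 p2 : ℂ → ℂ) : Prop :=
  ContDiff ℝ (⊤ : ℕ∞) p1 ∧ ContDiff ℝ (⊤ : ℕ∞) p2 ∧
  (∀ z, wd p1 z = (1/2) * (wd (cx u) z * p1 z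
      + Complex.I * Complex.exp (-(u z : ℂ)) * p2 z)) ∧
  (∀ z, wd p2 z = (1/2) * (Complex.I * lam⁻¹ * Complex.exp ((u z : ℂ)) * p1 z
      - wd (cx u) z * p2 z)) ∧
  (∀ z, wdb p1 z = (1/2) * (-(wdb (cx u) z) * p1 z
      + Complex.I * lam * Complex.exp ((u z : ℂ)) * p2 z)) ∧
  (∀ z, wdb p2 z = (1/2) * (Complex.I * Complex.exp (-(u z : ℂ)) * p1 z
      + wdb (cx u) z * p2 z))

/-- `(φ₁, φ₂)` solves the system `(Φ_λ)`. -/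
def SolPhi (u : ℂ → ℝ) (lam : ℂ) (f1 f2 : ℂ → ℂ) : Prop :=
  ContDiff ℝ (⊤ : ℕ∞) f1 ∧ ContDiff ℝ (⊤ : ℕ∞) f2 ∧
  (∀ z, wd f1 z = -(1/2) * (wd (cx u) z * f1 z
      + Complex.I * lam⁻¹ * Complex.exp ((u z : ℂ)) * f2 z)) ∧
  (∀ z, wd f2 z = -(1/2) * (Complex.I * Complex.exp (-(u z : ℂ)) * f1 z
      - wd (cx u) z * f2 z)) ∧
  (∀ z, wdb f1 z = -(1/2) * (-(wdb (cx u) z) * f1 z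
      + Complex.I * Complex.exp (-(u z : ℂ)) * f2 z)) ∧
  (∀ z, wdb f2 z = -(1/2) * (Complex.I * lam * Complex.exp ((u z : ℂ)) * f1 z
      + wdb (cx u) z * f2 z))

/-- The matrix `A_λ = (1/2) [[∂u, iλ⁻¹e^u], [ie^{-u}, -∂u]]`. -/
def matA (u : ℂ → ℝ) (lam : ℂ) (z : ℂ) : Matrix (Fin 2) (Fin 2) ℂ :=
  ((1:ℂ)/2) • !![wd (cx u) z, Complex.I * lam⁻¹ * Complex.exp ((u z : ℂ));
    Complex.I * Complex.exp (-(u z : ℂ)), -(wd (cx u) z)]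

/-- The matrix `B_λ = (1/2) [[-∂̄u, ie^{-u}], [iλe^u, ∂̄u]]`. -/
def matB (u : ℂ → ℝ) (lam : ℂ) (z : ℂ) : Matrix (Fin 2) (Fin 2) ℂ :=
  ((1:ℂ)/2) • !![-(wdb (cx u) z), Complex.I * Complex.exp (-(u z : ℂ));
    Complex.I * lam * Complex.exp ((u z : ℂ)), wdb (cx u) z]

section Wirtinger

variable {f g : ℂ → ℂ} {z : ℂ}

theorem wd_mul (hf : DifferentiableAt ℝ f z) (hg : DifferentiableAt ℝ g z) :
    wd (fun w => f w * g w) z = wd f z * g z + f z * wd g z := by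
  simp only [wd, fderiv_fun_mul hf hg, _root_.add_apply, _root_.smul_apply, smul_eq_mul]
  ring

theorem wd_sub (hf : DifferentiableAt ℝ f z) (hg : DifferentiableAt ℝ g z) :
    wd (fun w => f w - g w) z = wd f z - wd g z := by
  simp only [wd, fderiv_fun_sub hf hg, _root_.sub_apply]
  ring

theorem wd_neg : wd (fun w => -f w) z = -wd f z := by
  simp only [wd, fderiv_fun_neg, _root_.neg_apply]
  ring

theorem wd_const_mul (c : ℂ) (hf : DifferentiableAt ℝ f z) :
    wd (fun w => c * f w) z = c * wd f z := by
  simp only [wd, fderiv_const_mul hf, _root_.smul_apply, smul_eq_mul]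
  ring

theorem wd_cexp (hf : DifferentiableAt ℝ f z) :
    wd (fun w => Complex.exp (f w)) z = Complex.exp (f z) * wd f z := by
  simp only [wd, hf.hasFDerivAt.cexp.fderiv, _root_.smul_apply, smul_eq_mul]
  ring

end Wirtinger

section Systems

variable {u : ℂ → ℝ} {lam : ℂ} {p1 p2 f1 f2 : ℂ → ℂ}

theorem differentiable_cx (hu : Differentiable ℝ u) : Differentiable ℝ (cx u) :=
  Complex.ofRealCLM.differentiable.comp hu

theorem SolPsi.differentiable (h : SolPsi u lam p1 p2) :
    Differentiable ℝ p1 ∧ Differentiable ℝ p2 :=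
  ⟨h.1.differentiable (by simp), h.2.1.differentiable (by simp)⟩

theorem SolPhi.differentiable (h : SolPhi u lam f1 f2) :
    Differentiable ℝ f1 ∧ Differentiable ℝ f2 :=
  ⟨h.1.differentiable (by simp), h.2.1.differentiable (by simp)⟩

/-- `∂ω = i e^{-u} ψ₂φ₁ - i λ⁻¹ e^u ψ₁φ₂`. -/
theorem wd_omega (hpsi : SolPsi u lam p1 p2) (hphi : SolPhi u lam f1 f2) (z : ℂ) :
    wd (fun w => p1 w * f1 w - p2 w * f2 w) z
      = Complex.I * (Complex.exp (-cx u z) * (p2 z * f1 z))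
        - Complex.I * lam⁻¹ * (Complex.exp (cx u z) * (p1 z * f2 z)) := by
  obtain ⟨hp1, hp2⟩ := hpsi.differentiable
  obtain ⟨hf1, hf2⟩ := hphi.differentiable
  obtain ⟨-, -, dp1, dp2, -, -⟩ := hpsi
  obtain ⟨-, -, df1, df2, -, -⟩ := hphi
  rw [wd_sub ((hp1 z).fun_mul (hf1 z)) ((hp2 z).fun_mul (hf2 z)), wd_mul (hp1 z) (hf1 z),
    wd_mul (hp2 z) (hf2 z), dp1, dp2, df1, df2]
  simp only [cx]
  ring

/-- `∂(e^{-u} ψ₂φ₁) = -2 ∂u e^{-u} ψ₂φ₁ + (i/2) λ⁻¹ ω`. -/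
theorem wd_exp_neg_mul (hu : Differentiable ℝ u) (hpsi : SolPsi u lam p1 p2)
    (hphi : SolPhi u lam f1 f2) (z : ℂ) :
    wd (fun w => Complex.exp (-cx u w) * (p2 w * f1 w)) z
      = -2 * wd (cx u) z * (Complex.exp (-cx u z) * (p2 z * f1 z))
        + Complex.I / 2 * lam⁻¹ * (p1 z * f1 z - p2 z * f2 z) := by
  have hcx := differentiable_cx hu
  obtain ⟨-, hp2⟩ := hpsi.differentiable
  obtain ⟨hf1, -⟩ := hphi.differentiable
  have hexp : Complex.exp (-cx u z) * Complex.exp (cx u z) = 1 := by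
    rw [← Complex.exp_add, neg_add_cancel, Complex.exp_zero]
  rw [wd_mul (hcx z).fun_neg.cexp ((hp2 z).fun_mul (hf1 z)), wd_cexp (hcx z).fun_neg, wd_neg,
    wd_mul (hp2 z) (hf1 z), hpsi.2.2.2.1, hphi.2.2.1]
  change _ * _ * _ + _ * ((1 / 2 * (_ * Complex.exp (cx u z) * _ - _)) * _
    + _ * (-(1 / 2) * (_ + _ * Complex.exp (cx u z) * _))) = _
  linear_combination Complex.I / 2 * lam⁻¹ * (p1 z * f1 z - p2 z * f2 z) * hexp

/-- `∂(e^u ψ₁φ₂) = 2 ∂u e^u ψ₁φ₂ - (i/2) ω`. -/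
theorem wd_exp_mul (hu : Differentiable ℝ u) (hpsi : SolPsi u lam p1 p2)
    (hphi : SolPhi u lam f1 f2) (z : ℂ) :
    wd (fun w => Complex.exp (cx u w) * (p1 w * f2 w)) z
      = 2 * wd (cx u) z * (Complex.exp (cx u z) * (p1 z * f2 z))
        - Complex.I / 2 * (p1 z * f1 z - p2 z * f2 z) := by
  have hcx := differentiable_cx hu
  obtain ⟨hp1, -⟩ := hpsi.differentiable
  obtain ⟨-, hf2⟩ := hphi.differentiable
  have hexp : Complex.exp (-cx u z) * Complex.exp (cx u z) = 1 := by
    rw [← Complex.exp_add, neg_add_cancel, Complex.exp_zero]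
  rw [wd_mul (hcx z).cexp ((hp1 z).fun_mul (hf2 z)), wd_cexp (hcx z),
    wd_mul (hp1 z) (hf2 z), hpsi.2.2.1, hphi.2.2.2.1]
  change _ * _ * _ + _ * ((1 / 2 * (_ + _ * Complex.exp (-cx u z) * _)) * _
    + _ * (-(1 / 2) * (_ * Complex.exp (-cx u z) * _ - _))) = _
  linear_combination -Complex.I / 2 * (p1 z * f1 z - p2 z * f2 z) * hexp

/-- The Wirtinger derivative of a combination of `e^{-u} ψ₂φ₁` and `e^u ψ₁φ₂`. -/
theorem wd_exp_combination (hu : Differentiable ℝ u) (hpsi : SolPsi u lam p1 p2)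
    (hphi : SolPhi u lam f1 f2) (a b z : ℂ) :
    wd (fun w => a * (Complex.exp (-cx u w) * (p2 w * f1 w))
        - b * (Complex.exp (cx u w) * (p1 w * f2 w))) z
      = a * (-2 * wd (cx u) z * (Complex.exp (-cx u z) * (p2 z * f1 z))
          + Complex.I / 2 * lam⁻¹ * (p1 z * f1 z - p2 z * f2 z))
        - b * (2 * wd (cx u) z * (Complex.exp (cx u z) * (p1 z * f2 z))
          - Complex.I / 2 * (p1 z * f1 z - p2 z * f2 z)) := by
  have hcx := differentiable_cx hu
  obtain ⟨hp1, hp2⟩ := hpsi.differentiable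
  obtain ⟨hf1, hf2⟩ := hphi.differentiable
  have h1 : DifferentiableAt ℝ (fun w => Complex.exp (-cx u w) * (p2 w * f1 w)) z :=
    (hcx z).fun_neg.cexp.fun_mul ((hp2 z).fun_mul (hf1 z))
  have h2 : DifferentiableAt ℝ (fun w => Complex.exp (cx u w) * (p1 w * f2 w)) z :=
    (hcx z).cexp.fun_mul ((hp1 z).fun_mul (hf2 z))
  rw [wd_sub (h1.const_mul a) (h2.const_mul b), wd_const_mul a h1, wd_const_mul b h2,
    wd_exp_neg_mul hu hpsi hphi, wd_exp_mul hu hpsi hphi]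

end Systems

/-- `∂φ = 2∂u·∂ω` and `λ⁻¹ω = 2φ∂u - ∂²ω`. -/
theorem statement12 (u : ℂ → ℝ) (hu : ContDiff ℝ (⊤ : ℕ∞) u) (lam : ℂ) (hlam : lam ≠ 0)
    (p1 p2 f1 f2 : ℂ → ℂ) (hpsi : SolPsi u lam p1 p2) (hphi : SolPhi u lam f1 f2) :
    (∀ z, wd (fun w => -(Complex.I) * Complex.exp (-(u w : ℂ)) * p2 w * f1 w
          - Complex.I * lam⁻¹ * Complex.exp ((u w : ℂ)) * p1 w * f2 w) z
        = 2 * wd (cx u) z * wd (fun w => p1 w * f1 w - p2 w * f2 w) z) ∧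
    (∀ z, lam⁻¹ * (p1 z * f1 z - p2 z * f2 z)
        = 2 * (-(Complex.I) * Complex.exp (-(u z : ℂ)) * p2 z * f1 z
            - Complex.I * lam⁻¹ * Complex.exp ((u z : ℂ)) * p1 z * f2 z) * wd (cx u) z
          - wd (wd (fun w => p1 w * f1 w - p2 w * f2 w)) z) := by
  have hu' : Differentiable ℝ u := hu.differentiable (by simp)
  refine ⟨fun z => ?_, fun z => ?_⟩
  · have hfun : (fun w => -(Complex.I) * Complex.exp (-(u w : ℂ)) * p2 w * f1 w
          - Complex.I * lam⁻¹ * Complex.exp ((u w : ℂ)) * p1 w * f2 w)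
        = fun w => -Complex.I * (Complex.exp (-cx u w) * (p2 w * f1 w))
          - Complex.I * lam⁻¹ * (Complex.exp (cx u w) * (p1 w * f2 w)) := by
      funext w
      simp only [cx]
      ring
    rw [hfun, wd_exp_combination hu' hpsi hphi, wd_omega hpsi hphi]
    ring
  · rw [funext (wd_omega hpsi hphi), wd_exp_combination hu' hpsi hphi]
    simp only [cx]
    linear_combination (lam⁻¹ * (p1 z * f1 z - p2 z * f2 z)) * Complex.I_sq
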